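/- arXiv:2006.09480 — 3 statements merged into one kernel-verified Lean document; each statement's English description precedes it below -/
import Mathlib

section
/- Let T > 0 and let ρ, u : [0,1] × [0,T] → ℝ be smooth with ρ > 0, satisfying the continuity equation ρ_t + (ρ u)_x = 0 on (0,1) × (0,T), the boundary conditions u(0,t) = u(1,t) = 0 for all t, and the normalization ∫₀¹ ρ(x,0) dx = 1. Set Q(t) := ∫₀¹ ρ(x,t) ( (1/ρ)_x(x,t) )² dx and M := ∫₀ᵀ∫₀¹ u_{xx}(x,t)² dx dt. Then for all t ∈ [0,T], Q(t) ≤ ( Q(0) + 2M ) · exp( t + M ). -/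
open Set intervalIntegral

noncomputable section

/-- Spatial partial derivative of a function of `(x, t)`. -/
def pdx (f : ℝ → ℝ → ℝ) (x t : ℝ) : ℝ := deriv (fun y => f y t) x

/-- Time partial derivative of a function of `(x, t)`. -/
def pdt (f : ℝ → ℝ → ℝ) (x t : ℝ) : ℝ := deriv (fun s => f x s) t

/-- The quantity `Q(t) = ∫₀¹ ρ ((1/ρ)_x)² dx`. -/
def Qfun (ρ : ℝ → ℝ → ℝ) (t : ℝ) : ℝ :=
  ∫ x in (0:ℝ)..1, ρ x t * (pdx (fun y s => 1 / ρ y s) x t) ^ 2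

def Smo (f : ℝ → ℝ → ℝ) : Prop := ContDiff ℝ (⊤ : ℕ∞) (fun p : ℝ × ℝ => f p.1 p.2)

lemma Smo.hx0 {f : ℝ → ℝ → ℝ} (h : Smo f) (x t : ℝ) :
    HasDerivAt (fun y => f y t) (fderiv ℝ (fun p : ℝ × ℝ => f p.1 p.2) (x, t) (1, 0)) x := by
  have h1 : HasFDerivAt (fun p : ℝ × ℝ => f p.1 p.2) _ (x, t) :=
    (h.differentiable (by simp) (x, t)).hasFDerivAt
  exact h1.comp_hasDerivAt x (f := fun y : ℝ => (y, t))
    ((hasDerivAt_id x).prodMk (hasDerivAt_const x t))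

lemma Smo.ht0 {f : ℝ → ℝ → ℝ} (h : Smo f) (x t : ℝ) :
    HasDerivAt (fun s => f x s) (fderiv ℝ (fun p : ℝ × ℝ => f p.1 p.2) (x, t) (0, 1)) t := by
  have h1 : HasFDerivAt (fun p : ℝ × ℝ => f p.1 p.2) _ (x, t) :=
    (h.differentiable (by simp) (x, t)).hasFDerivAt
  exact h1.comp_hasDerivAt t (f := fun y : ℝ => (x, y))
    ((hasDerivAt_const t x).prodMk (hasDerivAt_id t))

lemma Smo.pdx_eq {f : ℝ → ℝ → ℝ} (h : Smo f) (x t : ℝ) :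
    pdx f x t = fderiv ℝ (fun p : ℝ × ℝ => f p.1 p.2) (x, t) (1, 0) := (h.hx0 x t).deriv
lemma Smo.pdt_eq {f : ℝ → ℝ → ℝ} (h : Smo f) (x t : ℝ) :
    pdt f x t = fderiv ℝ (fun p : ℝ × ℝ => f p.1 p.2) (x, t) (0, 1) := (h.ht0 x t).deriv

lemma Smo.hx {f : ℝ → ℝ → ℝ} (h : Smo f) (x t : ℝ) :
    HasDerivAt (fun y => f y t) (pdx f x t) x := h.pdx_eq x t ▸ h.hx0 x t
lemma Smo.ht {f : ℝ → ℝ → ℝ} (h : Smo f) (x t : ℝ) :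
    HasDerivAt (fun y => f x y) (pdt f x t) t := h.pdt_eq x t ▸ h.ht0 x t

lemma Smo.fd {f : ℝ → ℝ → ℝ} (h : Smo f) :
    ContDiff ℝ (⊤ : ℕ∞) (fderiv ℝ (fun p : ℝ × ℝ => f p.1 p.2)) :=
  ContDiff.fderiv_right (n := (⊤ : ℕ∞)) h (by simp)

lemma Smo.pdx {f : ℝ → ℝ → ℝ} (h : Smo f) : Smo (pdx f) := by
  have : (fun p : ℝ × ℝ => _root_.pdx f p.1 p.2) =
      fun p => fderiv ℝ (fun p : ℝ × ℝ => f p.1 p.2) p (1, 0) := by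
    ext p; exact h.pdx_eq p.1 p.2
  unfold Smo
  rw [this]
  exact h.fd.clm_apply contDiff_const

lemma Smo.pdt {f : ℝ → ℝ → ℝ} (h : Smo f) : Smo (pdt f) := by
  have : (fun p : ℝ × ℝ => _root_.pdt f p.1 p.2) =
      fun p => fderiv ℝ (fun p : ℝ × ℝ => f p.1 p.2) p (0, 1) := by
    ext p; exact h.pdt_eq p.1 p.2
  unfold Smo
  rw [this]
  exact h.fd.clm_apply contDiff_const

lemma Smo.cont {f : ℝ → ℝ → ℝ} (h : Smo f) : Continuous (fun p : ℝ × ℝ => f p.1 p.2) :=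
  ContDiff.continuous h

lemma Smo.contx {f : ℝ → ℝ → ℝ} (h : Smo f) (t : ℝ) : Continuous (fun x => f x t) :=
  h.cont.comp (by fun_prop : Continuous fun x : ℝ => (x, t))

lemma Smo.symm {f : ℝ → ℝ → ℝ} (h : Smo f) (x t : ℝ) :
    _root_.pdt (_root_.pdx f) x t = _root_.pdx (_root_.pdt f) x t := by
  set F := fun p : ℝ × ℝ => f p.1 p.2 with hF
  have e1 : (fun p : ℝ × ℝ => _root_.pdx f p.1 p.2) = fun p => fderiv ℝ F p (1, 0) := by
    ext p; exact h.pdx_eq p.1 p.2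
  have e2 : (fun p : ℝ × ℝ => _root_.pdt f p.1 p.2) = fun p => fderiv ℝ F p (0, 1) := by
    ext p; exact h.pdt_eq p.1 p.2
  have hd : DifferentiableAt ℝ (fderiv ℝ F) (x, t) := h.fd.differentiable (by simp) (x, t)
  rw [h.pdx.pdt_eq, h.pdt.pdx_eq, e1, e2, fderiv_clm_apply hd (by fun_prop),
    fderiv_clm_apply hd (by fun_prop)]
  simp
  have hs : IsSymmSndFDerivAt ℝ F (x, t) := by
    apply ContDiffAt.isSymmSndFDerivAt (n := (⊤ : ℕ∞)) (ContDiff.contDiffAt h)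
    simp only [minSmoothness_of_isRCLikeNormedField]
    exact WithTop.coe_le_coe.2 (le_top : (2:ℕ∞) ≤ ⊤)
  exact hs _ _

/-- clamp extension -/
lemma clamp_ext {q : ℝ → ℝ → ℝ} {T : ℝ} (hT : 0 < T)
    (hq : ContinuousOn (fun p : ℝ × ℝ => q p.1 p.2) (Icc 0 1 ×ˢ Icc 0 T)) :
    Continuous (fun p : ℝ × ℝ => q (projIcc (0:ℝ) 1 zero_le_one p.1) (projIcc 0 T hT.le p.2)) := by
  have : Continuous (fun p : ℝ × ℝ => (((projIcc (0:ℝ) 1 zero_le_one p.1 : ℝ)),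
      ((projIcc 0 T hT.le p.2 : ℝ)))) :=
    ((continuous_subtype_val.comp continuous_projIcc).comp continuous_fst).prodMk
    ((continuous_subtype_val.comp continuous_projIcc).comp continuous_snd)
  exact hq.comp_continuous this (fun p => ⟨Subtype.coe_prop _, Subtype.coe_prop _⟩)

lemma int_cont {q : ℝ → ℝ → ℝ} {T : ℝ} (hT : 0 < T)
    (hq : ContinuousOn (fun p : ℝ × ℝ => q p.1 p.2) (Icc 0 1 ×ˢ Icc 0 T)) :
    ContinuousOn (fun t => ∫ x in (0:ℝ)..1, q x t) (Icc 0 T) := by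
  have h := clamp_ext hT hq
  have h2 : Continuous (fun t => ∫ x in (0:ℝ)..1,
      q (projIcc (0:ℝ) 1 zero_le_one x) (projIcc 0 T hT.le t)) := by
    apply intervalIntegral.continuous_parametric_intervalIntegral_of_continuous'
    exact h.comp continuous_swap
  refine h2.continuousOn.congr ?_
  intro t ht
  apply intervalIntegral.integral_congr
  intro x hx
  rw [uIcc_of_le zero_le_one] at hx
  simp only [projIcc_of_mem _ hx, projIcc_of_mem _ ht]

lemma slice_cont {q : ℝ → ℝ → ℝ} {T : ℝ}
    (hq : ContinuousOn (fun p : ℝ × ℝ => q p.1 p.2) (Icc 0 1 ×ˢ Icc 0 T)) {t : ℝ}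
    (ht : t ∈ Icc 0 T) : ContinuousOn (fun x => q x t) (Icc 0 1) :=
  hq.comp (f := fun x : ℝ => (x, t)) (by fun_prop) (fun x hx => ⟨hx, ht⟩)

lemma int_deriv {q q' : ℝ → ℝ → ℝ} {T : ℝ}
    (hq : ContinuousOn (fun p : ℝ × ℝ => q p.1 p.2) (Icc 0 1 ×ˢ Icc 0 T))
    (hq' : ContinuousOn (fun p : ℝ × ℝ => q' p.1 p.2) (Icc 0 1 ×ˢ Icc 0 T))
    (hd : ∀ x ∈ Icc (0:ℝ) 1, ∀ t ∈ Ioo 0 T, HasDerivAt (fun s => q x s) (q' x t) t)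
    {t : ℝ} (ht : t ∈ Ioo 0 T) :
    HasDerivAt (fun t => ∫ x in (0:ℝ)..1, q x t) (∫ x in (0:ℝ)..1, q' x t) t := by
  obtain ⟨C, hC⟩ := (isCompact_Icc.prod isCompact_Icc).exists_bound_of_continuousOn hq'
  have meas : ∀ {f : ℝ → ℝ}, ContinuousOn f (Icc 0 1) →
      IntervalIntegrable f MeasureTheory.volume 0 1 := fun h =>
    ContinuousOn.intervalIntegrable (by rwa [uIcc_of_le zero_le_one])
  refine (intervalIntegral.hasDerivAt_integral_of_dominated_loc_of_deriv_le
    (F := fun t x => q x t) (F' := fun t x => q' x t) (bound := fun _ => C)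
    (Ioo_mem_nhds ht.1 ht.2) ?_ ?_ ?_ ?_ ?_ ?_).2
  · filter_upwards [Ioo_mem_nhds ht.1 ht.2] with s hs
    exact (meas (slice_cont hq ⟨hs.1.le, hs.2.le⟩)).def'.aestronglyMeasurable
  · exact meas (slice_cont hq ⟨ht.1.le, ht.2.le⟩)
  · exact (meas (slice_cont hq' ⟨ht.1.le, ht.2.le⟩)).def'.aestronglyMeasurable
  · refine Filter.Eventually.of_forall fun x hx s hs => ?_
    rw [uIoc_of_le zero_le_one] at hx
    exact hC (x, s) ⟨⟨hx.1.le, hx.2⟩, ⟨hs.1.le, hs.2.le⟩⟩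
  · simp
  · refine Filter.Eventually.of_forall fun x hx s hs => ?_
    rw [uIoc_of_le zero_le_one] at hx
    exact hd x ⟨hx.1.le, hx.2⟩ s hs

lemma v_bound {r r' : ℝ → ℝ} (hr : ∀ x, HasDerivAt r (r' x) x) (hc' : Continuous r')
    (hpos : ∀ x ∈ Icc (0:ℝ) 1, 0 < r x) (hm : ∫ x in (0:ℝ)..1, r x = 1) :
    ∀ x ∈ Icc (0:ℝ) 1, 1 / r x ≤ 2 + ∫ x in (0:ℝ)..1, r' x ^ 2 / r x ^ 3 := by
  have hc : Continuous r := continuous_iff_continuousAt.2 fun x => (hr x).continuousAt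
  have meas : ∀ {f : ℝ → ℝ}, ContinuousOn f (Icc 0 1) →
      IntervalIntegrable f MeasureTheory.volume 0 1 := fun h =>
    ContinuousOn.intervalIntegrable (by rwa [uIcc_of_le zero_le_one])
  obtain ⟨y, hy, hy1⟩ : ∃ y ∈ Icc (0:ℝ) 1, 1 ≤ r y := by
    by_contra! hcon
    have := intervalIntegral.integral_lt_integral_of_continuousOn_of_le_of_exists_lt
      (f := r) (g := fun _ => 1) zero_lt_one hc.continuousOn continuousOn_const
      (fun x hx => (hcon x ⟨hx.1.le, hx.2⟩).le) ⟨0, by simp, hcon 0 (by simp)⟩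
    simp [hm] at this
  set g : ℝ → ℝ := fun x => (√(r x))⁻¹ with hg
  set g' : ℝ → ℝ := fun x => -(r' x / (2 * √(r x))) / (√(r x)) ^ 2 with hg'
  have hgd : ∀ x ∈ Icc (0:ℝ) 1, HasDerivAt g (g' x) x := fun x hx =>
    ((hr x).sqrt (hpos x hx).ne').inv (Real.sqrt_pos.2 (hpos x hx)).ne'
  have hg'c : ContinuousOn g' (Icc 0 1) := by
    apply ContinuousOn.div
    · apply ContinuousOn.neg
      apply ContinuousOn.div hc'.continuousOn (by fun_prop)
      intro x hx
      have := Real.sqrt_pos.2 (hpos x hx)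
      positivity
    · fun_prop
    · intro x hx
      have := Real.sqrt_pos.2 (hpos x hx)
      positivity
  have hsq : ∀ x ∈ Icc (0:ℝ) 1, g' x ^ 2 = (1/4) * (r' x ^ 2 / r x ^ 3) := by
    intro x hx
    have h1 := Real.sqrt_pos.2 (hpos x hx)
    have h2 := Real.sq_sqrt (hpos x hx).le
    simp only [hg']
    rw [← h2, Real.sqrt_sq h1.le]
    field_simp
    norm_num
  have hI : ∫ x in (0:ℝ)..1, g' x ^ 2 = (1/4) * ∫ x in (0:ℝ)..1, r' x ^ 2 / r x ^ 3 := by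
    rw [← intervalIntegral.integral_const_mul]
    apply intervalIntegral.integral_congr
    intro x hx
    rw [uIcc_of_le zero_le_one] at hx
    exact hsq x hx
  set c := ∫ x in (0:ℝ)..1, |g' x| with hcdef
  have hc0 : 0 ≤ c := intervalIntegral.integral_nonneg zero_le_one fun x _ => abs_nonneg _
  have hCS : c ^ 2 ≤ ∫ x in (0:ℝ)..1, g' x ^ 2 := by
    have h0 : 0 ≤ ∫ x in (0:ℝ)..1, (|g' x| - c) ^ 2 :=
      intervalIntegral.integral_nonneg zero_le_one fun x _ => sq_nonneg _
    have e : ∀ x, (|g' x| - c) ^ 2 = g' x ^ 2 - 2 * c * |g' x| + c ^ 2 := by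
      intro x; rw [← sq_abs (g' x)]; ring
    simp_rw [e] at h0
    have i1 : IntervalIntegrable (fun x => g' x ^ 2) MeasureTheory.volume 0 1 := meas (hg'c.pow 2)
    have i2 : IntervalIntegrable (fun x => 2 * c * |g' x|) MeasureTheory.volume 0 1 :=
      meas (continuousOn_const.mul hg'c.abs)
    rw [intervalIntegral.integral_add (i1.sub i2) (by simp),
      intervalIntegral.integral_sub i1 i2,
      intervalIntegral.integral_const_mul] at h0
    simp at h0
    rw [← hcdef] at h0
    nlinarith
  intro x hx
  have hsub : uIcc y x ⊆ Icc 0 1 := by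
    rw [← uIcc_of_le (zero_le_one (α := ℝ))] at hx hy ⊢
    exact uIcc_subset_uIcc hy hx
  have hftc : ∫ z in y..x, g' z = g x - g y :=
    intervalIntegral.integral_eq_sub_of_hasDerivAt (fun z hz => hgd z (hsub hz))
      (hg'c.mono hsub).intervalIntegrable
  have habs : |g x - g y| ≤ c := by
    rw [← hftc]
    have h1 := intervalIntegral.norm_integral_le_integral_norm_uIoc (f := g') (a := y) (b := x)
      (μ := MeasureTheory.volume)
    rw [Real.norm_eq_abs] at h1
    refine h1.trans ?_
    rw [hcdef, intervalIntegral.integral_of_le zero_le_one]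
    apply MeasureTheory.setIntegral_mono_set
    · exact ((intervalIntegrable_iff_integrableOn_Ioc_of_le zero_le_one).1 (meas hg'c.abs))
    · exact Filter.Eventually.of_forall fun _ => abs_nonneg _
    · apply LE.le.eventuallyLE
      rintro z ⟨h1, h2⟩
      exact ⟨lt_of_le_of_lt (le_min hy.1 hx.1) h1, h2.trans (max_le hy.2 hx.2)⟩
  have hgy : g y ≤ 1 := by
    apply inv_le_one_of_one_le₀
    exact Real.one_le_sqrt.2 hy1
  have hgx : 0 ≤ g x := by positivity
  have hle : g x ≤ 1 + c := by linarith [le_abs_self (g x - g y)]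
  have : 1 / r x = g x ^ 2 := by
    simp only [hg]; rw [inv_pow, Real.sq_sqrt (hpos x hx).le, one_div]
  rw [this]
  have hQ : 0 ≤ ∫ x in (0:ℝ)..1, g' x ^ 2 := 
    intervalIntegral.integral_nonneg zero_le_one fun x _ => sq_nonneg _
  nlinarith [sq_nonneg (c - 1)]

lemma pde_pt {ρ u : ℝ → ℝ → ℝ} (hρ : Smo ρ) (hu : Smo u) (x t : ℝ) :
    pdx (fun y s => ρ y s * u y s) x t = pdx ρ x t * u x t + ρ x t * pdx u x t :=
  ((hρ.hx x t).mul (hu.hx x t)).deriv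

lemma pde_mixed {ρ u : ℝ → ℝ → ℝ} (hρ : Smo ρ) (hu : Smo u) {t : ℝ}
    (h : ∀ x ∈ Ioo (0:ℝ) 1, pdt ρ x t = -(pdx ρ x t * u x t + ρ x t * pdx u x t))
    {x : ℝ} (hx : x ∈ Ioo (0:ℝ) 1) :
    pdt (pdx ρ) x t = -((pdx (pdx ρ) x t * u x t + pdx ρ x t * pdx u x t)
      + (pdx ρ x t * pdx u x t + ρ x t * pdx (pdx u) x t)) := by
  rw [hρ.symm]
  have h1 : HasDerivAt (fun y => -(pdx ρ y t * u y t + ρ y t * pdx u y t)) _ x :=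
    (((hρ.pdx.hx x t).mul (hu.hx x t)).add ((hρ.hx x t).mul (hu.pdx.hx x t))).neg
  have h2 := h1.congr_of_eventuallyEq (f₁ := fun y => pdt ρ y t) (by
    filter_upwards [Ioo_mem_nhds hx.1 hx.2] with y hy
    exact h y hy)
  exact h2.deriv

lemma meas01 {f : ℝ → ℝ} (h : ContinuousOn f (Icc 0 1)) :
    IntervalIntegrable f MeasureTheory.volume 0 1 :=
  ContinuousOn.intervalIntegrable (by rwa [uIcc_of_le zero_le_one])

lemma mass_one {T : ℝ} {ρ u : ℝ → ℝ → ℝ} (hT : 0 < T) (hρ : Smo ρ) (hu : Smo u)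
    (h : ∀ x ∈ Ioo (0:ℝ) 1, ∀ t ∈ Ioo 0 T,
      pdt ρ x t = -(pdx ρ x t * u x t + ρ x t * pdx u x t))
    (hbdry : ∀ t, u 0 t = 0 ∧ u 1 t = 0)
    (hmass : (∫ x in (0:ℝ)..1, ρ x 0) = 1) :
    ∀ t ∈ Icc 0 T, (∫ x in (0:ℝ)..1, ρ x t) = 1 := by
  intro t ht
  rcases eq_or_lt_of_le ht.1 with rfl | h0
  · exact hmass
  have hd : ∀ s ∈ Ioo 0 t, HasDerivAt (fun t => ∫ x in (0:ℝ)..1, ρ x t) 0 s := by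
    intro s hs
    have hs' : s ∈ Ioo 0 T := ⟨hs.1, hs.2.trans_le ht.2⟩
    have h1 := int_deriv (q := ρ) (q' := pdt ρ) hρ.cont.continuousOn hρ.pdt.cont.continuousOn
      (fun x _ t _ => hρ.ht x t) hs'
    have h2 : ∫ x in (0:ℝ)..1, pdt ρ x s =
        ∫ x in (0:ℝ)..1, -(pdx ρ x s * u x s + ρ x s * pdx u x s) :=
      intervalIntegral.integral_congr_Ioo_of_le zero_le_one fun x hx => h x hx s hs'
    rw [h2, intervalIntegral.integral_neg, intervalIntegral.integral_eq_sub_of_hasDerivAt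
      (f := fun x => ρ x s * u x s) (fun x _ => (hρ.hx x s).mul (hu.hx x s)),
      (hbdry s).1, (hbdry s).2] at h1
    · simpa using h1
    · have := hρ.contx s
      have := hu.contx s
      have := hρ.pdx.contx s
      have := hu.pdx.contx s
      apply Continuous.intervalIntegrable
      fun_prop
  obtain ⟨c, -, hc⟩ := exists_hasDerivAt_eq_slope (fun t => ∫ x in (0:ℝ)..1, ρ x t) (fun _ => 0) h0
    ((int_cont hT hρ.cont.continuousOn).mono (Icc_subset_Icc le_rfl ht.2)) hd
  rw [eq_comm, div_eq_zero_iff] at hc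
  rcases hc with hc | hc
  · linarith
  · linarith

lemma Q_deriv {T : ℝ} {ρ u : ℝ → ℝ → ℝ} (hρ : Smo ρ) (hu : Smo u)
    (hpos : ∀ x ∈ Icc (0:ℝ) 1, ∀ t ∈ Icc (0:ℝ) T, 0 < ρ x t)
    (h : ∀ x ∈ Ioo (0:ℝ) 1, ∀ t ∈ Ioo 0 T,
      pdt ρ x t = -(pdx ρ x t * u x t + ρ x t * pdx u x t))
    (hbdry : ∀ t, u 0 t = 0 ∧ u 1 t = 0)
    {t : ℝ} (ht : t ∈ Ioo 0 T) (hm : (∫ x in (0:ℝ)..1, ρ x t) = 1) :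
    ∃ d, HasDerivAt (fun t => ∫ x in (0:ℝ)..1, pdx ρ x t ^ 2 / ρ x t ^ 3) d t ∧
      d ≤ (∫ x in (0:ℝ)..1, pdx ρ x t ^ 2 / ρ x t ^ 3) +
        (2 + ∫ x in (0:ℝ)..1, pdx ρ x t ^ 2 / ρ x t ^ 3) *
        ∫ x in (0:ℝ)..1, pdx (pdx u) x t ^ 2 := by
  have ht' : t ∈ Icc 0 T := ⟨ht.1.le, ht.2.le⟩
  have hcq : ContinuousOn (fun p : ℝ × ℝ => pdx ρ p.1 p.2 ^ 2 / ρ p.1 p.2 ^ 3)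
      (Icc 0 1 ×ˢ Icc 0 T) :=
    ContinuousOn.div (hρ.pdx.cont.pow 2).continuousOn (hρ.cont.pow 3).continuousOn
      fun p hp => (pow_pos (hpos p.1 hp.1 p.2 hp.2) 3).ne'
  set qt : ℝ → ℝ → ℝ := fun x t => (2 * pdx ρ x t * pdt (pdx ρ) x t * ρ x t ^ 3 -
    pdx ρ x t ^ 2 * (3 * ρ x t ^ 2 * pdt ρ x t)) / (ρ x t ^ 3) ^ 2 with hqt
  have hcqt : ContinuousOn (fun p : ℝ × ℝ => qt p.1 p.2) (Icc 0 1 ×ˢ Icc 0 T) := by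
    have := hρ.cont
    have := hρ.pdx.cont
    have := hρ.pdt.cont
    have := hρ.pdx.pdt.cont
    refine ContinuousOn.div (Continuous.continuousOn ?_) (Continuous.continuousOn ?_)
      fun p hp => (pow_pos (pow_pos (hpos p.1 hp.1 p.2 hp.2) 3) 2).ne'
    · fun_prop
    · fun_prop
  refine ⟨_, int_deriv (q' := qt) hcq hcqt ?_ ht, ?_⟩
  · intro x hx s hs
    have h3 := (pow_pos (hpos x hx s ⟨hs.1.le, hs.2.le⟩) 3).ne'
    have := ((hρ.pdx.ht x s).pow 2).div ((hρ.ht x s).pow 3) h3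
    refine this.congr_deriv ?_
    simp [hqt]
  set Q := ∫ x in (0:ℝ)..1, pdx ρ x t ^ 2 / ρ x t ^ 3 with hQ
  have hv := v_bound (r := fun x => ρ x t) (r' := fun x => pdx ρ x t) (fun x => hρ.hx x t)
    (hρ.pdx.contx t) (fun x hx => hpos x hx t ht') hm
  rw [← hQ] at hv
  set D : ℝ → ℝ := fun x => pdx u x t * (pdx ρ x t ^ 2 / ρ x t ^ 3) +
    u x t * ((2 * pdx ρ x t * pdx (pdx ρ) x t * ρ x t ^ 3 -
    pdx ρ x t ^ 2 * (3 * ρ x t ^ 2 * pdx ρ x t)) / (ρ x t ^ 3) ^ 2) with hD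
  have c1 := hρ.contx t
  have c2 := hu.contx t
  have c3 := hρ.pdx.contx t
  have c4 := hu.pdx.contx t
  have c5 := hu.pdx.pdx.contx t
  have c6 := hρ.pdx.pdx.contx t
  have iq := slice_cont (q := fun x t => pdx ρ x t ^ 2 / ρ x t ^ 3) hcq ht'
  have iqt := slice_cont hcqt ht'
  have iD : ContinuousOn D (Icc 0 1) := by
    refine (c4.continuousOn.mul iq).add (c2.continuousOn.mul ?_)
    refine ContinuousOn.div (Continuous.continuousOn ?_) (Continuous.continuousOn ?_)
      fun p hp => (pow_pos (pow_pos (hpos p hp t ht') 3) 2).ne'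
    · fun_prop
    · fun_prop
  have hID : ∫ x in (0:ℝ)..1, D x = 0 := by
    rw [intervalIntegral.integral_eq_sub_of_hasDerivAt
      (f := fun x => u x t * (pdx ρ x t ^ 2 / ρ x t ^ 3)) ?_ (meas01 iD),
      (hbdry t).1, (hbdry t).2]
    · simp
    · intro x hx
      rw [uIcc_of_le zero_le_one] at hx
      have h3 := (pow_pos (hpos x hx t ht') 3).ne'
      have := (hu.hx x t).mul (((hρ.pdx.hx x t).pow 2).div ((hρ.hx x t).pow 3) h3)
      refine this.congr_deriv ?_
      simp [hD]
  have e1 : ∫ x in (0:ℝ)..1, qt x t = ∫ x in (0:ℝ)..1, (qt x t + D x) := by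
    rw [intervalIntegral.integral_add (meas01 iqt) (meas01 iD), hID, add_zero]
  have i5 : ContinuousOn (fun x => (2 + Q) * pdx (pdx u) x t ^ 2) (Icc 0 1) := by fun_prop
  have e2 : Q + (2 + Q) * ∫ x in (0:ℝ)..1, pdx (pdx u) x t ^ 2 =
      ∫ x in (0:ℝ)..1, (pdx ρ x t ^ 2 / ρ x t ^ 3 + (2 + Q) * pdx (pdx u) x t ^ 2) := by
    rw [intervalIntegral.integral_add (meas01 iq) (meas01 i5),
      intervalIntegral.integral_const_mul]
  rw [e1, e2]
  apply intervalIntegral.integral_mono_on_of_le_Ioo zero_le_one (meas01 (iqt.add iD))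
    (meas01 (iq.add i5))
  intro x hx
  have hx' : x ∈ Icc (0:ℝ) 1 := ⟨hx.1.le, hx.2.le⟩
  have hp := hpos x hx' t ht'
  have hv1 := hv x hx'
  have m1 := pde_mixed hρ hu (fun x hx => h x hx t ht) hx
  have m2 := h x hx t ht
  have e3 : qt x t + D x = -2 * (pdx ρ x t / ρ x t ^ 2) * pdx (pdx u) x t := by
    simp only [hqt, hD, m1, m2]
    field_simp
    ring
  change qt x t + D x ≤ pdx ρ x t ^ 2 / ρ x t ^ 3 + (2 + Q) * pdx (pdx u) x t ^ 2
  rw [e3]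
  have h5 : -2 * (pdx ρ x t / ρ x t ^ 2) * pdx (pdx u) x t ≤
      pdx ρ x t ^ 2 / ρ x t ^ 3 + 1 / ρ x t * pdx (pdx u) x t ^ 2 := by
    have : pdx ρ x t ^ 2 / ρ x t ^ 3 + 1 / ρ x t * pdx (pdx u) x t ^ 2 -
      (-2 * (pdx ρ x t / ρ x t ^ 2) * pdx (pdx u) x t) =
      1 / ρ x t * (pdx ρ x t / ρ x t + pdx (pdx u) x t) ^ 2 := by
      field_simp
      ring
    have h6 : 0 ≤ 1 / ρ x t * (pdx ρ x t / ρ x t + pdx (pdx u) x t) ^ 2 := by positivity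
    linarith
  have h7 := mul_le_mul_of_nonneg_right hv1 (sq_nonneg (pdx (pdx u) x t))
  linarith

lemma Q_eq {T : ℝ} {ρ : ℝ → ℝ → ℝ} (hρ : Smo ρ)
    (hpos : ∀ x ∈ Icc (0:ℝ) 1, ∀ t ∈ Icc (0:ℝ) T, 0 < ρ x t) {t : ℝ} (ht : t ∈ Icc 0 T) :
    Qfun ρ t = ∫ x in (0:ℝ)..1, pdx ρ x t ^ 2 / ρ x t ^ 3 := by
  apply intervalIntegral.integral_congr
  intro x hx
  rw [uIcc_of_le zero_le_one] at hx
  have hp := hpos x hx t ht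
  have : pdx (fun y s => 1 / ρ y s) x t = -pdx ρ x t / ρ x t ^ 2 := by
    simp only [one_div]
    exact ((hρ.hx x t).inv hp.ne').deriv
  simp only [this]
  field_simp

lemma gron {T : ℝ} (hT : 0 < T) {Q m : ℝ → ℝ} (hQc : ContinuousOn Q (Icc 0 T))
    (hm : Continuous m) (hm0 : ∀ t, 0 ≤ m t) (hQ0 : ∀ t ∈ Icc 0 T, 0 ≤ Q t)
    (hd : ∀ t ∈ Ioo 0 T, ∃ d, HasDerivAt Q d t ∧ d ≤ Q t + (2 + Q t) * m t) :
    ∀ t ∈ Icc 0 T, Q t ≤ (Q 0 + 2 * ∫ s in (0:ℝ)..T, m s) *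
      Real.exp (t + ∫ s in (0:ℝ)..T, m s) := by
  set N : ℝ → ℝ := fun t => ∫ s in (0:ℝ)..t, m s with hN
  have hNd : ∀ t, HasDerivAt N (m t) t := fun t =>
    intervalIntegral.integral_hasDerivAt_right (hm.intervalIntegrable _ _)
      hm.stronglyMeasurable.stronglyMeasurableAtFilter hm.continuousAt
  have hNc : Continuous N := continuous_iff_continuousAt.2 fun x => (hNd x).continuousAt
  have hNm : Monotone N := monotone_of_hasDerivAt_nonneg hNd hm0
  have hN0 : N 0 = 0 := by simp [hN]
  set G : ℝ → ℝ := fun t => Q t * Real.exp (-(t + N t)) - 2 * N t with hG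
  have hGa : AntitoneOn G (Icc 0 T) := by
    have key : ∀ t ∈ Ioo 0 T, ∃ d, HasDerivAt G d t ∧ d ≤ 0 := by
      intro t ht
      obtain ⟨d, h1, h2⟩ := hd t ht
      refine ⟨_, (h1.mul ((((hasDerivAt_id t).add (hNd t)).neg).exp)).sub
        ((hNd t).const_mul 2), ?_⟩
      simp only [Pi.add_apply, id, Pi.neg_apply]
      have hn : 0 ≤ N t := hN0 ▸ hNm ht.1.le
      have hE : Real.exp (-(t + N t)) ≤ 1 := Real.exp_le_one_iff.2 (by linarith [ht.1])
      have hE0 := Real.exp_pos (-(t + N t))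
      have := mul_le_mul_of_nonneg_right h2 hE0.le
      have := mul_le_mul_of_nonneg_right hE (hm0 t)
      nlinarith
    apply antitoneOn_of_deriv_nonpos (convex_Icc _ _)
    · have : Continuous fun t => Real.exp (-(t + N t)) := by fun_prop
      exact (hQc.mul this.continuousOn).sub (by fun_prop)
    · rw [interior_Icc]
      intro t ht
      obtain ⟨d, h1, h2⟩ := key t ht
      exact h1.differentiableAt.differentiableWithinAt
    · rw [interior_Icc]
      intro t ht
      obtain ⟨d, h1, h2⟩ := key t ht
      rwa [h1.deriv]
  intro t ht
  have h1 := hGa ⟨le_rfl, hT.le⟩ ht ht.1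
  simp only [hG, hN0] at h1
  simp at h1
  have hNT : N t ≤ N T := hNm ht.2
  have hn : 0 ≤ N t := hN0 ▸ hNm ht.1
  have hq0 := hQ0 0 ⟨le_rfl, hT.le⟩
  have h2 : Q t * Real.exp (-(t + N t)) ≤ Q 0 + 2 * N t := by
    have e : -(t + N t) = -N t + -t := by ring
    rw [e]; linarith
  rw [Real.exp_neg, ← div_eq_mul_inv, div_le_iff₀ (Real.exp_pos _)] at h2
  refine h2.trans ?_
  apply mul_le_mul _ _ (Real.exp_pos _).le _
  · linarith
  · exact Real.exp_le_exp.2 (by linarith)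
  · change 0 ≤ Q 0 + 2 * N T
    linarith

/-- For a smooth positive density `ρ` and velocity `u` satisfying
the continuity equation on `(0,1) × (0,T)`, vanishing of `u` at the endpoints and
`∫₀¹ ρ(·,0) = 1`, the quantity `Q(t) = ∫₀¹ ρ ((1/ρ)_x)²` obeys the Gronwall bound
`Q(t) ≤ (Q(0) + 2M) exp(t + M)` where `M = ∫₀ᵀ∫₀¹ u_{xx}²`. -/
theorem density_Q_gronwall_bound
    (T : ℝ) (hT : 0 < T)
    (ρ u : ℝ → ℝ → ℝ)
    (hρ : ContDiff ℝ (⊤ : ℕ∞) (fun p : ℝ × ℝ => ρ p.1 p.2))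
    (hu : ContDiff ℝ (⊤ : ℕ∞) (fun p : ℝ × ℝ => u p.1 p.2))
    (hρpos : ∀ x ∈ Icc (0:ℝ) 1, ∀ t ∈ Icc (0:ℝ) T, 0 < ρ x t)
    (hcont : ∀ x ∈ Ioo (0:ℝ) 1, ∀ t ∈ Ioo (0:ℝ) T,
      pdt ρ x t + pdx (fun y s => ρ y s * u y s) x t = 0)
    (hbdry : ∀ t, u 0 t = 0 ∧ u 1 t = 0)
    (hmass : (∫ x in (0:ℝ)..1, ρ x 0) = 1) :
    ∀ t ∈ Icc (0:ℝ) T,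
      Qfun ρ t ≤
        (Qfun ρ 0 + 2 * ∫ t in (0:ℝ)..T, ∫ x in (0:ℝ)..1, (pdx (pdx u) x t) ^ 2)
          * Real.exp (t + ∫ t in (0:ℝ)..T, ∫ x in (0:ℝ)..1, (pdx (pdx u) x t) ^ 2) := by
  have hρ' : Smo ρ := hρ
  have hu' : Smo u := hu
  have hpde : ∀ x ∈ Ioo (0:ℝ) 1, ∀ t ∈ Ioo 0 T,
      pdt ρ x t = -(pdx ρ x t * u x t + ρ x t * pdx u x t) := by
    intro x hx t ht
    have := hcont x hx t ht
    rw [pde_pt hρ' hu'] at this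
    linarith
  have hmass' := mass_one hT hρ' hu' hpde hbdry hmass
  have hcq : ContinuousOn (fun p : ℝ × ℝ => pdx ρ p.1 p.2 ^ 2 / ρ p.1 p.2 ^ 3)
      (Icc 0 1 ×ˢ Icc 0 T) :=
    ContinuousOn.div (hρ'.pdx.cont.pow 2).continuousOn (hρ'.cont.pow 3).continuousOn
      fun p hp => (pow_pos (hρpos p.1 hp.1 p.2 hp.2) 3).ne'
  have hmc : Continuous fun t => ∫ x in (0:ℝ)..1, (pdx (pdx u) x t) ^ 2 := by
    apply intervalIntegral.continuous_parametric_intervalIntegral_of_continuous'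
    exact (hu'.pdx.pdx.cont.comp continuous_swap).pow 2
  intro t ht
  rw [Q_eq hρ' hρpos ht, Q_eq hρ' hρpos (t := 0) ⟨le_rfl, hT.le⟩]
  exact gron hT (int_cont (q := fun x t => pdx ρ x t ^ 2 / ρ x t ^ 3) hT hcq) hmc
    (fun t => intervalIntegral.integral_nonneg zero_le_one fun x _ => sq_nonneg _)
    (fun t ht => intervalIntegral.integral_nonneg zero_le_one fun x hx =>
      div_nonneg (sq_nonneg _) (pow_pos (hρpos x hx t ht) 3).le)
    (fun t ht => Q_deriv hρ' hu' hρpos hpde hbdry ht (hmass' t ⟨ht.1.le, ht.2.le⟩)) t ht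

end
end

section
/- Let δ > 0 and γ = 1 + 2δ. Let ρ : [0,1] → ℝ be continuously differentiable with ρ > 0. Then sup_{x ∈ [0,1]} ρ(x)^δ ≤ ( ∫₀¹ ρ(x)^γ dx )^{δ/γ} + δ ( ∫₀¹ ρ(x)^γ dx )^{1/2} ( ∫₀¹ ρ(x) ( (1/ρ)'(x) )² dx )^{1/2}, where (1/ρ)' denotes the derivative of x ↦ 1/ρ(x). -/
open Set intervalIntegral

lemma cs_aux (f g : ℝ → ℝ) (hf : ContinuousOn f (Icc 0 1)) (hg : ContinuousOn g (Icc 0 1)) :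
    (∫ x in (0:ℝ)..1, f x * g x) ^ 2 ≤
      (∫ x in (0:ℝ)..1, f x ^ 2) * (∫ x in (0:ℝ)..1, g x ^ 2) := by
  have hI : ∀ u : ℝ → ℝ, ContinuousOn u (Icc 0 1) →
      IntervalIntegrable u MeasureTheory.volume 0 1 := fun u hu =>
    ContinuousOn.intervalIntegrable (by rwa [uIcc_of_le zero_le_one])
  have i1 := hI (fun x => f x ^ 2) (hf.pow 2)
  have i2 := hI (fun x => f x * g x) (hf.mul hg)
  have i3 := hI (fun x => g x ^ 2) (hg.pow 2)
  have key : ∀ t : ℝ, 0 ≤ (∫ x in (0:ℝ)..1, f x ^ 2) * (t * t)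
      + (2 * ∫ x in (0:ℝ)..1, f x * g x) * t + ∫ x in (0:ℝ)..1, g x ^ 2 := by
    intro t
    have e : (∫ x in (0:ℝ)..1, (t * f x + g x) ^ 2) = (∫ x in (0:ℝ)..1, f x ^ 2) * (t * t)
      + (2 * ∫ x in (0:ℝ)..1, f x * g x) * t + ∫ x in (0:ℝ)..1, g x ^ 2 := by
      have e1 : (fun x => (t * f x + g x) ^ 2) =
          fun x => ((t * t) * f x ^ 2 + (2 * t) * (f x * g x)) + g x ^ 2 := by
        funext x; ring
      rw [e1, integral_add ((i1.const_mul _).add (i2.const_mul _)) i3,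
        integral_add (i1.const_mul _) (i2.const_mul _), integral_const_mul, integral_const_mul]
      ring
    rw [← e]
    exact integral_nonneg zero_le_one (fun x _ => sq_nonneg _)
  have := discrim_le_zero key
  unfold discrim at this
  nlinarith

/-- For `δ > 0`, `γ = 1 + 2δ`, and a continuously differentiable
positive density `ρ` on `[0,1]`,
`sup ρ^δ ≤ (∫₀¹ ρ^γ)^{δ/γ} + δ (∫₀¹ ρ^γ)^{1/2} (∫₀¹ ρ ((1/ρ)')²)^{1/2}`.
Here `g'` is the (continuous) derivative of `x ↦ 1/ρ(x)` on `[0,1]` and all powers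
are real powers. -/
theorem density_rpow_pointwise_bound
    (δ γ : ℝ) (hδ : 0 < δ) (hγ : γ = 1 + 2 * δ)
    (ρ g' : ℝ → ℝ)
    (hρC1 : ContDiffOn ℝ 1 ρ (Icc 0 1))
    (hρpos : ∀ x ∈ Icc (0:ℝ) 1, 0 < ρ x)
    (hg' : ∀ x ∈ Icc (0:ℝ) 1, HasDerivWithinAt (fun y => 1 / ρ y) (g' x) (Icc 0 1) x)
    (hg'cont : ContinuousOn g' (Icc 0 1)) :
    ∀ x ∈ Icc (0:ℝ) 1,
      ρ x ^ δ ≤ (∫ x in (0:ℝ)..1, ρ x ^ γ) ^ (δ / γ)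
        + δ * (∫ x in (0:ℝ)..1, ρ x ^ γ) ^ ((1:ℝ) / 2)
            * (∫ x in (0:ℝ)..1, ρ x * (g' x) ^ 2) ^ ((1:ℝ) / 2) := by
  intro x hx
  have hρc : ContinuousOn ρ (Icc 0 1) := hρC1.continuousOn
  have hpow : ∀ p : ℝ, ContinuousOn (fun x => ρ x ^ p) (Icc 0 1) := fun p =>
    hρc.rpow_const (fun x hx => Or.inl (hρpos x hx).ne')
  have hI : ∀ u : ℝ → ℝ, ContinuousOn u (Icc 0 1) →
      IntervalIntegrable u MeasureTheory.volume 0 1 := fun u hu =>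
    ContinuousOn.intervalIntegrable (by rwa [uIcc_of_le zero_le_one])
  have hγ0 : 0 < γ := by linarith
  obtain ⟨y, hy, hmin⟩ := isCompact_Icc.exists_isMinOn (nonempty_Icc.2 (zero_le_one (α := ℝ))) hρc
  set A := ∫ x in (0:ℝ)..1, ρ x ^ γ with hA
  set B := ∫ x in (0:ℝ)..1, ρ x * (g' x) ^ 2 with hB
  have hA1 : ρ y ^ γ ≤ A := by
    have := integral_mono_on (zero_le_one (α := ℝ)) (intervalIntegrable_const (c := ρ y ^ γ))
      (hI _ (hpow γ)) (fun z hz => Real.rpow_le_rpow (hρpos y hy).le (hmin hz) hγ0.le)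
    simpa using this
  have hyA : ρ y ^ δ ≤ A ^ (δ / γ) := by
    have h := Real.rpow_le_rpow (Real.rpow_nonneg (hρpos y hy).le γ) hA1 (div_pos hδ hγ0).le
    rwa [← Real.rpow_mul (hρpos y hy).le, mul_div_cancel₀ _ hγ0.ne'] at h
  -- derivative
  have hder : ∀ z ∈ Icc (0:ℝ) 1,
      HasDerivWithinAt (fun w => ρ w ^ δ) (-δ * (ρ z ^ (δ + 1) * g' z)) (Icc 0 1) z := by
    intro z hz
    have hp := hρpos z hz
    have h := (hg' z hz).rpow_const (p := -δ) (Or.inl (one_div_pos.2 hp).ne')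
    have h2 : HasDerivWithinAt (fun w => ρ w ^ δ) (g' z * (-δ) * (1 / ρ z) ^ (-δ - 1))
        (Icc 0 1) z := by
      refine h.congr_of_mem (fun w hw => ?_) hz
      rw [one_div, Real.inv_rpow (hρpos w hw).le, Real.rpow_neg (hρpos w hw).le, inv_inv]
    convert h2 using 1
    rw [one_div, Real.inv_rpow hp.le, ← Real.rpow_neg hp.le]
    rw [show -(-δ - 1) = δ + 1 by ring]
    ring
  have hsub : uIcc y x ⊆ Icc (0:ℝ) 1 := by
    rw [← uIcc_of_le (zero_le_one (α := ℝ))] at hx hy ⊢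
    exact uIcc_subset_uIcc hy hx
  have hdc : ContinuousOn (fun z => -δ * (ρ z ^ (δ + 1) * g' z)) (Icc 0 1) :=
    continuousOn_const.mul ((hpow _).mul hg'cont)
  have hftc : ∫ z in y..x, -δ * (ρ z ^ (δ + 1) * g' z) = ρ x ^ δ - ρ y ^ δ := by
    refine integral_eq_sub_of_hasDeriv_right (f := fun w => ρ w ^ δ) ((hpow δ).mono hsub) ?_
      (hdc.mono hsub).intervalIntegrable
    intro z hz
    have hz' : z ∈ Ioo (0:ℝ) 1 :=
      ⟨lt_of_le_of_lt (le_min hy.1 hx.1) hz.1, lt_of_lt_of_le hz.2 (max_le hy.2 hx.2)⟩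
    exact ((hder z (Ioo_subset_Icc_self hz')).hasDerivAt
      (Icc_mem_nhds hz'.1 hz'.2)).hasDerivWithinAt
  have hle : ρ x ^ δ - ρ y ^ δ ≤ ∫ z in (0:ℝ)..1, |(-δ * (ρ z ^ (δ + 1) * g' z))| := by
    rw [← hftc]
    refine (le_abs_self _).trans ?_
    have h1 : |∫ z in y..x, -δ * (ρ z ^ (δ + 1) * g' z)| ≤
        abs (∫ z in y..x, abs (-δ * (ρ z ^ (δ + 1) * g' z))) := by
      simpa only [Real.norm_eq_abs] using norm_integral_le_abs_integral_norm
        (f := fun z => -δ * (ρ z ^ (δ + 1) * g' z)) (a := y) (b := x)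
        (μ := MeasureTheory.volume)
    refine h1.trans ?_
    have h2 := abs_integral_mono_interval (a := y) (b := x) (c := 0) (d := 1)
      (μ := MeasureTheory.volume) (f := fun z => |(-δ * (ρ z ^ (δ + 1) * g' z))|)
      (uIoc_subset_uIoc_of_uIcc_subset_uIcc (by rwa [uIcc_of_le (zero_le_one (α := ℝ))]))
      (Filter.Eventually.of_forall (fun z => abs_nonneg _)) (hI _ hdc.abs)
    refine h2.trans (le_of_eq (abs_of_nonneg ?_))
    exact integral_nonneg zero_le_one (fun z _ => abs_nonneg _)
  have heq : ∫ z in (0:ℝ)..1, |(-δ * (ρ z ^ (δ + 1) * g' z))| =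
      δ * ∫ z in (0:ℝ)..1, ρ z ^ (δ + 1/2) * (ρ z ^ ((1:ℝ)/2) * |g' z|) := by
    rw [← integral_const_mul]
    refine integral_congr (fun z hz => ?_)
    rw [uIcc_of_le (zero_le_one (α := ℝ))] at hz
    have hp := hρpos z hz
    rw [abs_mul, abs_mul, abs_neg, abs_of_pos hδ, abs_of_pos (Real.rpow_pos_of_pos hp _),
      ← mul_assoc (ρ z ^ (δ + 1/2)), ← Real.rpow_add hp]
    congr 3
    ring
  have hcs := cs_aux (fun z => ρ z ^ (δ + 1/2)) (fun z => ρ z ^ ((1:ℝ)/2) * |g' z|)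
    (hpow _) ((hpow _).mul hg'cont.abs)
  have hA2 : ∫ z in (0:ℝ)..1, (ρ z ^ (δ + 1/2)) ^ 2 = A := by
    refine integral_congr (fun z hz => ?_)
    rw [uIcc_of_le (zero_le_one (α := ℝ))] at hz
    have hp := hρpos z hz
    rw [← Real.rpow_mul_natCast hp.le, hγ]
    congr 1
    push_cast
    ring
  have hB2 : ∫ z in (0:ℝ)..1, (ρ z ^ ((1:ℝ)/2) * |g' z|) ^ 2 = B := by
    refine integral_congr (fun z hz => ?_)
    rw [uIcc_of_le (zero_le_one (α := ℝ))] at hz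
    have hp := hρpos z hz
    rw [mul_pow, sq_abs, ← Real.sqrt_eq_rpow, Real.sq_sqrt hp.le]
  simp only [hA2, hB2] at hcs
  have hA0 : 0 ≤ A := (Real.rpow_nonneg (hρpos y hy).le γ).trans hA1
  have hfin := Real.le_sqrt_of_sq_le hcs
  rw [Real.sqrt_mul hA0] at hfin
  rw [heq] at hle
  rw [← Real.sqrt_eq_rpow, ← Real.sqrt_eq_rpow, mul_assoc]
  have := mul_le_mul_of_nonneg_left hfin hδ.le
  linarith
end

section
/- Let γ > 1 be a real number and let a, b ≥ 0 be real numbers. Then |a − b|^{γ+1} ≤ (a^γ − b^γ)(a − b). In particular, (a^γ − b^γ)(a − b) ≥ 0. -/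
theorem abs_sub_aux (γ : ℝ) (hγ : 1 < γ) (a b : ℝ) (hb : 0 ≤ b) (hab : b ≤ a) :
    |a - b| ^ (γ + 1) ≤ (a ^ γ - b ^ γ) * (a - b) := by
  have h0 : 0 ≤ a - b := sub_nonneg.2 hab
  have h := Real.add_rpow_le_rpow_add h0 hb hγ.le
  rw [sub_add_cancel] at h
  rw [abs_of_nonneg h0, Real.rpow_add_one' h0 (by linarith)]
  exact mul_le_mul_of_nonneg_right (by linarith) h0

/-- For `γ > 1` and nonnegative reals `a, b`, one has
`|a - b| ^ (γ + 1) ≤ (a ^ γ - b ^ γ) * (a - b)`; in particular the right-hand side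
is nonnegative.  Powers are real (`rpow`) powers. -/
theorem abs_sub_rpow_le_sub_rpow_mul_sub (γ : ℝ) (hγ : 1 < γ) (a b : ℝ)
    (ha : 0 ≤ a) (hb : 0 ≤ b) :
    |a - b| ^ (γ + 1) ≤ (a ^ γ - b ^ γ) * (a - b) ∧
      0 ≤ (a ^ γ - b ^ γ) * (a - b) := by
  have key : |a - b| ^ (γ + 1) ≤ (a ^ γ - b ^ γ) * (a - b) := by
    rcases le_total b a with h | h
    · exact abs_sub_aux γ hγ a b hb h
    · have := abs_sub_aux γ hγ b a ha h
      rw [abs_sub_comm]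
      linarith
  exact ⟨key, (Real.rpow_nonneg (abs_nonneg _) _).trans key⟩
end
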